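/- arXiv:2009.03499 — 9 statements merged into one kernel-verified Lean document; each statement's English description precedes it below -/
import Mathlib

section
/- Let m, n be positive integers and let M be an n×n real magic square with magic sum μ. Then the Kronecker product A = E_m ⊗ M satisfies: every row sum of A equals m·μ, every column sum of A equals m·μ, the trace of A equals m·μ, and the antidiagonal sum trace((R_m ⊗ R_n) * A) equals m·μ; i.e., A is a magic square (on the index type Fin m × Fin n) with magic sum m·μ. -/
open Matrix Kronecker BigOperators

/-- The `n × n` all-ones matrix. -/
noncomputable def E (n : ℕ) : Matrix (Fin n) (Fin n) ℝ := Matrix.of fun _ _ => 1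

/-- The `n × n` exchange matrix. -/
noncomputable def R (n : ℕ) : Matrix (Fin n) (Fin n) ℝ :=
  Matrix.of fun i j => if (i : ℕ) + (j : ℕ) = n - 1 then 1 else 0

theorem trace_E (n : ℕ) : (E n).trace = n := by
  simp [E, Matrix.trace]

theorem R_apply_eq_ite_rev {n : ℕ} (i j : Fin n) : R n i j = if j = i.rev then 1 else 0 := by
  have h : (i : ℕ) + j = n - 1 ↔ j = i.rev := by
    rw [Fin.ext_iff, Fin.val_rev]
    omega
  simp [R, h]

theorem trace_R_mul_E (n : ℕ) : (R n * E n).trace = n := by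
  simp [Matrix.trace, Matrix.mul_apply, R_apply_eq_ite_rev, E]

/-- Compounding a magic square with the all-ones matrix: `E_m ⊗ M` is a magic square
with magic sum `m·μ`. -/
theorem compound_allOnes_kron_magic (m n : ℕ) (hm : 0 < m) (hn : 0 < n)
    (M : Matrix (Fin n) (Fin n) ℝ) (μ : ℝ)
    (hrow : ∀ i, ∑ j, M i j = μ)
    (hcol : ∀ j, ∑ i, M i j = μ)
    (htr : Matrix.trace M = μ)
    (hanti : Matrix.trace (R n * M) = μ) :
    (∀ p, ∑ q, (E m ⊗ₖ M) p q = (m : ℝ) * μ) ∧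
    (∀ q, ∑ p, (E m ⊗ₖ M) p q = (m : ℝ) * μ) ∧
    Matrix.trace (E m ⊗ₖ M) = (m : ℝ) * μ ∧
    Matrix.trace ((R m ⊗ₖ R n) * (E m ⊗ₖ M)) = (m : ℝ) * μ := by
  refine ⟨fun p => ?_, fun q => ?_, ?_, ?_⟩
  · simp [Fintype.sum_prod_type, E, hrow]
  · simp [Fintype.sum_prod_type, E, hcol]
  · rw [trace_kronecker, trace_E, htr]
  · rw [← mul_kronecker_mul, trace_kronecker, trace_R_mul_E, hanti]
end

section
/- Let m, n be positive integers, let M_m be an m×m real matrix with all row sums and column sums equal to μ_m, and let M_n be an n×n real matrix with all row sums and column sums equal to μ_n. Set A = E_m ⊗ M_n, B = M_m ⊗ E_n, M^A = A + n² • B, and M^B = B + m² • A. Then M^A * M^B = M^B * M^A. -/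
open Matrix Kronecker BigOperators

/-- A matrix whose row sums and column sums all equal `μ` commutes with the all-ones matrix. -/
theorem commute_E_of_sums {n : ℕ} {M : Matrix (Fin n) (Fin n) ℝ} {μ : ℝ}
    (hrow : ∀ i, ∑ j, M i j = μ) (hcol : ∀ j, ∑ i, M i j = μ) : Commute (E n) M := by
  ext i j
  simp [E, Matrix.mul_apply, hrow, hcol]

/-- The compounded magic squares `M^A = A + n² • B` and `M^B = B + m² • A` commute,
where `A = E_m ⊗ M_n` and `B = M_m ⊗ E_n`. -/
theorem compound_euler_commute (m n : ℕ) (hm : 0 < m) (hn : 0 < n)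
    (Mm : Matrix (Fin m) (Fin m) ℝ) (Mn : Matrix (Fin n) (Fin n) ℝ) (μm μn : ℝ)
    (hmrow : ∀ i, ∑ j, Mm i j = μm)
    (hmcol : ∀ j, ∑ i, Mm i j = μm)
    (hnrow : ∀ i, ∑ j, Mn i j = μn)
    (hncol : ∀ j, ∑ i, Mn i j = μn) :
    ((E m ⊗ₖ Mn) + ((n : ℝ)^2) • (Mm ⊗ₖ E n)) * ((Mm ⊗ₖ E n) + ((m : ℝ)^2) • (E m ⊗ₖ Mn))
      = ((Mm ⊗ₖ E n) + ((m : ℝ)^2) • (E m ⊗ₖ Mn)) * ((E m ⊗ₖ Mn) + ((n : ℝ)^2) • (Mm ⊗ₖ E n)) := by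
  have hAB : Commute (E m ⊗ₖ Mn) (Mm ⊗ₖ E n) := by
    rw [Commute, SemiconjBy, ← Matrix.mul_kronecker_mul, ← Matrix.mul_kronecker_mul,
      (commute_E_of_sums hmrow hmcol).eq, (commute_E_of_sums hnrow hncol).eq]
  have hA := (Commute.refl (E m ⊗ₖ Mn)).smul_right ((m : ℝ) ^ 2)
  have hB := Commute.refl (Mm ⊗ₖ E n)
  exact ((hAB.add_right hA).add_left
    ((hB.add_right (hAB.symm.smul_right _)).smul_left _)).eq
end

section
/- Let m, n be positive integers and let M be an n×n real matrix that is regular, i.e., M + R_n * M * R_n = c • E_n for some real constant c. Then A = E_m ⊗ M satisfies A + (R_m ⊗ R_n) * A * (R_m ⊗ R_n) = c • (E_m ⊗ E_n); i.e., A is regular with the same constant c. -/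
open Matrix Kronecker BigOperators

theorem R_mul_E (n : ℕ) : R n * E n = E n := by
  ext i j
  have h (k : Fin n) : (i : ℕ) + (k : ℕ) = n - 1 ↔ k = Fin.rev i := by
    rw [Fin.ext_iff, Fin.val_rev]
    omega
  simp [R, E, Matrix.mul_apply, h]

theorem E_mul_R (n : ℕ) : E n * R n = E n := by
  ext i j
  have h (k : Fin n) : (k : ℕ) + (j : ℕ) = n - 1 ↔ k = Fin.rev j := by
    rw [Fin.ext_iff, Fin.val_rev]
    omega
  simp [R, E, Matrix.mul_apply, h]

/-- If `M` is regular with constant `c`, then `A = E_m ⊗ M` is regular with the same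
constant `c`. -/
theorem compound_allOnes_kron_regular (m n : ℕ) (hm : 0 < m) (hn : 0 < n)
    (M : Matrix (Fin n) (Fin n) ℝ) (c : ℝ)
    (hreg : M + R n * M * R n = c • E n) :
    (E m ⊗ₖ M) + (R m ⊗ₖ R n) * (E m ⊗ₖ M) * (R m ⊗ₖ R n) = c • (E m ⊗ₖ E n) := by
  rw [← mul_kronecker_mul, ← mul_kronecker_mul, R_mul_E, E_mul_R, ← kronecker_add, hreg,
    kronecker_smul]
end

section
/- Let m, n be positive integers and let M be an m×m real matrix that is regular, i.e., M + R_m * M * R_m = c • E_m for some real constant c. Then B = M ⊗ E_n satisfies B + (R_m ⊗ R_n) * B * (R_m ⊗ R_n) = c • (E_m ⊗ E_n); i.e., B is regular with the same constant c. -/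
open Matrix Kronecker BigOperators

/-- Every row of the exchange matrix sums to one. -/
theorem sum_R_row (n : ℕ) (i : Fin n) : ∑ j, R n i j = 1 := by
  have h (j : Fin n) : R n i j = if j = i.rev then 1 else 0 := by
    simp only [R, Matrix.of_apply, Fin.ext_iff, Fin.val_rev]
    congr 1
    apply propext
    omega
  simp [h]

/-- The exchange matrix is symmetric. -/
theorem R_apply_comm (n : ℕ) (i j : Fin n) : R n i j = R n j i := by
  simp [R, add_comm]

/-- If `M` is regular with constant `c`, then `B = M ⊗ E_n` is regular with the same
constant `c`. -/
theorem compound_kron_allOnes_regular (m n : ℕ) (hm : 0 < m) (hn : 0 < n)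
    (M : Matrix (Fin m) (Fin m) ℝ) (c : ℝ)
    (hreg : M + R m * M * R m = c • E m) :
    (M ⊗ₖ E n) + (R m ⊗ₖ R n) * (M ⊗ₖ E n) * (R m ⊗ₖ R n) = c • (E m ⊗ₖ E n) := by
  rw [← Matrix.mul_kronecker_mul, ← Matrix.mul_kronecker_mul, R_mul_E, E_mul_R,
    ← Matrix.add_kronecker, hreg, Matrix.smul_kronecker]
end

section
/- Let m, n be positive integers, let M_m be an m×m real matrix with M_m + R_m * M_m * R_m = (m² − 1) • E_m, and let M_n be an n×n real matrix with M_n + R_n * M_n * R_n = (n² − 1) • E_n. Set A = E_m ⊗ M_n, B = M_m ⊗ E_n, and M^A = A + n² • B. Then M^A + (R_m ⊗ R_n) * M^A * (R_m ⊗ R_n) = (m²·n² − 1) • (E_m ⊗ E_n); i.e., regularity is preserved under compounding. -/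
open Matrix Kronecker BigOperators

theorem exchange_apply (n : ℕ) (i j : Fin n) : R n i j = if j = i.rev then 1 else 0 := by
  have h : (i : ℕ) + (j : ℕ) = n - 1 ↔ j = i.rev := by
    rw [Fin.ext_iff, Fin.val_rev]
    omega
  simp only [R, of_apply, h]

theorem exchange_mul (n : ℕ) (M : Matrix (Fin n) (Fin n) ℝ) :
    R n * M = M.submatrix Fin.rev id := by
  ext i j
  simp [mul_apply, exchange_apply]

theorem mul_exchange (n : ℕ) (M : Matrix (Fin n) (Fin n) ℝ) :
    M * R n = M.submatrix id Fin.rev := by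
  ext i j
  simp [mul_apply, exchange_apply, ← Fin.rev_eq_iff]

theorem exchange_mul_allOnes_mul_exchange (n : ℕ) : R n * E n * R n = E n := by
  rw [exchange_mul, mul_exchange]
  rfl

/-- Regularity is preserved by Euler composition: if `M_m` is regular with constant
`m² - 1` and `M_n` is regular with constant `n² - 1`, then
`M^A = (E_m ⊗ M_n) + n² • (M_m ⊗ E_n)` is regular with constant `m²n² - 1`. -/
theorem euler_composition_regular (m n : ℕ) (hm : 0 < m) (hn : 0 < n)
    (Mm : Matrix (Fin m) (Fin m) ℝ) (Mn : Matrix (Fin n) (Fin n) ℝ)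
    (hmreg : Mm + R m * Mm * R m = ((m : ℝ)^2 - 1) • E m)
    (hnreg : Mn + R n * Mn * R n = ((n : ℝ)^2 - 1) • E n) :
    ((E m ⊗ₖ Mn) + ((n : ℝ)^2) • (Mm ⊗ₖ E n)) +
      (R m ⊗ₖ R n) * ((E m ⊗ₖ Mn) + ((n : ℝ)^2) • (Mm ⊗ₖ E n)) * (R m ⊗ₖ R n)
      = ((m : ℝ)^2 * (n : ℝ)^2 - 1) • (E m ⊗ₖ E n) := by
  have hA : (R m ⊗ₖ R n) * (E m ⊗ₖ Mn) * (R m ⊗ₖ R n) = E m ⊗ₖ (R n * Mn * R n) := by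
    rw [← mul_kronecker_mul, ← mul_kronecker_mul, exchange_mul_allOnes_mul_exchange]
  have hB : (R m ⊗ₖ R n) * (Mm ⊗ₖ E n) * (R m ⊗ₖ R n) = (R m * Mm * R m) ⊗ₖ E n := by
    rw [← mul_kronecker_mul, ← mul_kronecker_mul, exchange_mul_allOnes_mul_exchange]
  rw [Matrix.mul_add, Matrix.add_mul, Matrix.mul_smul, Matrix.smul_mul, hA, hB,
    eq_sub_of_add_eq' hmreg, eq_sub_of_add_eq' hnreg]
  ext ⟨i, k⟩ ⟨j, l⟩
  simp only [E, Matrix.add_apply, Matrix.sub_apply, Matrix.smul_apply,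
    kronecker_apply, of_apply, smul_eq_mul]
  ring
end

section
/- Let n be a positive integer and let M be an n×n real matrix with E_n * M = μ • E_n (all column sums of M equal μ). Let λ be a real number with λ ≠ μ, let k be a positive integer, and let s be a vector with (M − λ • I)^k applied to s equal to the zero vector (s is a generalized eigenvector of M for the eigenvalue λ). Then E_n applied to s is the zero vector, i.e., the coordinates of s sum to zero. -/
open Matrix BigOperators

theorem mul_pow_eq_smul_of_mul_eq_smul {R A : Type*} [CommSemiring R] [Semiring A] [Algebra R A]
    {a b : A} {c : R} (h : a * b = c • a) (k : ℕ) : a * b ^ k = c ^ k • a := by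
  induction k with
  | zero => simp
  | succ k ih => rw [pow_succ, ← mul_assoc, ih, smul_mul_assoc, h, smul_smul, pow_succ]

/-- A generalized eigenvector of a matrix with constant column sums `μ`, for an
eigenvalue `λ ≠ μ`, has coordinates summing to zero. -/
theorem generalized_eigenvector_sum_zero (n : ℕ) (hn : 0 < n)
    (M : Matrix (Fin n) (Fin n) ℝ) (μ lam : ℝ)
    (hM : E n * M = μ • E n)
    (hlam : lam ≠ μ)
    (k : ℕ) (hk : 0 < k)
    (s : Fin n → ℝ)
    (hs : ((M - lam • (1 : Matrix (Fin n) (Fin n) ℝ)) ^ k).mulVec s = 0) :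
    (E n).mulVec s = 0 := by
  have h : E n * (M - lam • (1 : Matrix (Fin n) (Fin n) ℝ)) = (μ - lam) • E n := by
    rw [mul_sub, hM, mul_smul_comm, mul_one, sub_smul]
  have h_smul : (μ - lam) ^ k • (E n).mulVec s = 0 := by
    rw [← smul_mulVec, ← mul_pow_eq_smul_of_mul_eq_smul h k, ← mulVec_mulVec, hs, mulVec_zero]
  exact (smul_eq_zero.mp h_smul).resolve_left (pow_ne_zero k (sub_ne_zero.mpr hlam.symm))
end

section
/- Let m, n be positive integers and let M be any n×n real matrix. Then the characteristic polynomial of the Kronecker product E_m ⊗ M (a matrix indexed by Fin m × Fin n) equals X^{n(m−1)} times the characteristic polynomial of m • M. In particular, the nonzero eigenvalues of E_m ⊗ M are m times the nonzero eigenvalues of M, and 0 is an eigenvalue of multiplicity at least n(m−1). -/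
open Matrix Kronecker Polynomial BigOperators

theorem charpoly_allOnes_kron_eq (m n : ℕ) (hm : 0 < m) (M : Matrix (Fin n) (Fin n) ℝ) :
    (E m ⊗ₖ M).charpoly = Polynomial.X ^ (n * (m - 1)) * ((m : ℝ) • M).charpoly := by
  let A : Matrix (Fin m × Fin n) (Fin n) ℝ := M.submatrix Prod.snd id
  let B : Matrix (Fin n) (Fin m × Fin n) ℝ := (1 : Matrix (Fin n) (Fin n) ℝ).submatrix id Prod.snd
  have hAB : A * B = E m ⊗ₖ M := by
    ext ⟨i, k⟩ ⟨j, l⟩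
    simp [A, B, E, Matrix.mul_apply, Matrix.one_apply]
  have hBA : B * A = (m : ℝ) • M := by
    ext k l
    simp [A, B, Matrix.mul_apply, Matrix.one_apply, Fintype.sum_prod_type]
  have hle : Fintype.card (Fin n) ≤ Fintype.card (Fin m × Fin n) := by
    simpa using Nat.le_mul_of_pos_left n hm
  rw [← hAB, Matrix.charpoly_mul_comm_of_le A B hle, hBA]
  simp [Nat.mul_sub, Nat.mul_comm]

theorem isRoot_charpoly_smul {ι K : Type*} [Fintype ι] [DecidableEq ι] [Field K]
    (M : Matrix ι ι K) {a : K} (ha : a ≠ 0) (c : K) :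
    (a • M).charpoly.IsRoot c ↔ M.charpoly.IsRoot (c / a) := by
  have h : Matrix.scalar ι c - a • M = a • (Matrix.scalar ι (c / a) - M) := by
    ext i j
    by_cases hij : i = j <;> simp [hij, mul_sub, mul_div_cancel₀ c ha]
  rw [Polynomial.IsRoot.def, Polynomial.IsRoot.def, Matrix.eval_charpoly, Matrix.eval_charpoly, h,
    Matrix.det_smul]
  simp [ha]

/-- The characteristic polynomial of `E_m ⊗ M` is `X^{n(m-1)}` times that of `m • M`.
In particular the nonzero eigenvalues of `E_m ⊗ M` are `m` times the nonzero
eigenvalues of `M`, and `0` is an eigenvalue of multiplicity at least `n(m-1)`. -/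
theorem charpoly_allOnes_kron (m n : ℕ) (hm : 0 < m) (hn : 0 < n)
    (M : Matrix (Fin n) (Fin n) ℝ) :
    (E m ⊗ₖ M).charpoly = Polynomial.X ^ (n * (m - 1)) * ((m : ℝ) • M).charpoly ∧
    (∀ c : ℝ, c ≠ 0 → ((E m ⊗ₖ M).charpoly.IsRoot c ↔ M.charpoly.IsRoot (c / (m : ℝ)))) ∧
    n * (m - 1) ≤ (E m ⊗ₖ M).charpoly.rootMultiplicity 0 := by
  have h := charpoly_allOnes_kron_eq m n hm M
  refine ⟨h, fun c hc => ?_, ?_⟩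
  · rw [← isRoot_charpoly_smul M (Nat.cast_ne_zero.mpr hm.ne') c, h]
    simp [Polynomial.IsRoot.def, hc]
  · rw [Polynomial.le_rootMultiplicity_iff (Matrix.charpoly_monic _).ne_zero, h]
    simp
end

section
/- Let m, n be positive integers and let M be any m×m real matrix. Then the characteristic polynomial of the Kronecker product M ⊗ E_n (a matrix indexed by Fin m × Fin n) equals X^{m(n−1)} times the characteristic polynomial of n • M. -/
open Matrix Kronecker Polynomial BigOperators

/-- The characteristic polynomial of `M ⊗ E_n` is `X^{m(n-1)}` times that of `n • M`. -/
theorem charpoly_kron_allOnes (m n : ℕ) (hm : 0 < m) (hn : 0 < n)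
    (M : Matrix (Fin m) (Fin m) ℝ) :
    (M ⊗ₖ E n).charpoly = Polynomial.X ^ (m * (n - 1)) * ((n : ℝ) • M).charpoly := by
  let A : Matrix (Fin m × Fin n) (Fin m) ℝ := Matrix.of fun p j => M p.1 j
  let B : Matrix (Fin m) (Fin m × Fin n) ℝ := Matrix.of fun j p => if j = p.1 then 1 else 0
  have hAB : M ⊗ₖ E n = A * B := by
    ext ⟨i, k⟩ ⟨j, l⟩
    simp [A, B, E, Matrix.mul_apply]
  have hBA : B * A = (n : ℝ) • M := by
    ext i j
    simp [A, B, Matrix.mul_apply, Fintype.sum_prod_type]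
  have hle : Fintype.card (Fin m) ≤ Fintype.card (Fin m × Fin n) := by
    simpa using Nat.le_mul_of_pos_right m hn
  rw [hAB, Matrix.charpoly_mul_comm_of_le A B hle, hBA]
  simp [Nat.mul_sub]
end

section
/- Let m, n be positive integers. Let M_m be an m×m real matrix whose entries are exactly the numbers 0, 1, …, m² − 1, each occurring once (the entry map (i,j) ↦ M_m i j is injective with image {0, 1, …, m² − 1} ⊆ ℝ), and likewise let M_n be an n×n real matrix whose entries are exactly 0, 1, …, n² − 1, each occurring once. Set M^A = (E_m ⊗ M_n) + n² • (M_m ⊗ E_n), a matrix indexed by Fin m × Fin n. Then the entries of M^A are exactly the numbers 0, 1, …, (m·n)² − 1, each occurring exactly once: for every natural number v < (m·n)², there is a unique pair of indices (p, q) with M^A p q = v. -/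
open Matrix Kronecker BigOperators

/-- Euler composition of two natural squares is natural: if the entries of `M_m` are
exactly `0, …, m² - 1` and those of `M_n` are exactly `0, …, n² - 1`, then the entries
of `M^A = (E_m ⊗ M_n) + n² • (M_m ⊗ E_n)` are exactly `0, …, (mn)² - 1`, each occurring
exactly once. -/
theorem euler_composition_natural (m n : ℕ) (hm : 0 < m) (hn : 0 < n)
    (Mm : Matrix (Fin m) (Fin m) ℝ) (Mn : Matrix (Fin n) (Fin n) ℝ)
    (hMmInj : Function.Injective fun p : Fin m × Fin m => Mm p.1 p.2)
    (hMmRange : Set.range (fun p : Fin m × Fin m => Mm p.1 p.2)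
      = (fun v : ℕ => (v : ℝ)) '' {v : ℕ | v < m ^ 2})
    (hMnInj : Function.Injective fun p : Fin n × Fin n => Mn p.1 p.2)
    (hMnRange : Set.range (fun p : Fin n × Fin n => Mn p.1 p.2)
      = (fun v : ℕ => (v : ℝ)) '' {v : ℕ | v < n ^ 2}) :
    ∀ v : ℕ, v < (m * n) ^ 2 →
      ∃! pq : (Fin m × Fin n) × (Fin m × Fin n),
        ((E m ⊗ₖ Mn) + ((n : ℝ)^2) • (Mm ⊗ₖ E n)) pq.1 pq.2 = (v : ℝ) := by
  have entry (i j : Fin m) (k l : Fin n) :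
      ((E m ⊗ₖ Mn) + ((n : ℝ) ^ 2) • (Mm ⊗ₖ E n)) (i, k) (j, l)
        = Mn k l + (n : ℝ) ^ 2 * Mm i j := by
    simp [E]
  have hn2 : 0 < n ^ 2 := pow_pos hn 2
  intro v hv
  have hdiv : v / n ^ 2 < m ^ 2 := by
    rw [Nat.div_lt_iff_lt_mul hn2, ← mul_pow]
    exact hv
  have hmod : v % n ^ 2 < n ^ 2 := Nat.mod_lt _ hn2
  obtain ⟨⟨i, j⟩, hij : Mm i j = (v / n ^ 2 : ℕ)⟩ := hMmRange.ge ⟨_, hdiv, rfl⟩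
  obtain ⟨⟨k, l⟩, hkl : Mn k l = (v % n ^ 2 : ℕ)⟩ := hMnRange.ge ⟨_, hmod, rfl⟩
  refine ⟨((i, k), (j, l)), ?_, ?_⟩
  · dsimp only
    rw [entry, hij, hkl]
    exact_mod_cast Nat.mod_add_div v (n ^ 2)
  · rintro ⟨⟨i', k'⟩, ⟨j', l'⟩⟩ h
    dsimp only at h
    obtain ⟨a, -, ha : (a : ℝ) = Mm i' j'⟩ := hMmRange.le ⟨(i', j'), rfl⟩
    obtain ⟨b, hb, hb' : (b : ℝ) = Mn k' l'⟩ := hMnRange.le ⟨(k', l'), rfl⟩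
    rw [entry, ← ha, ← hb'] at h
    have hv' : b + n ^ 2 * a = v := by exact_mod_cast h
    obtain ⟨hva, hvb⟩ := (Nat.div_mod_unique hn2).2 ⟨hv', hb⟩
    have hm_eq : (i', j') = (i, j) := hMmInj (by simp only [← ha, hij, hva])
    have hn_eq : (k', l') = (k, l) := hMnInj (by simp only [← hb', hkl, hvb])
    simp_all
end
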